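/- Let η, C₀ be real numbers with η ≥ 1, C₀ ≥ 1, and set C̃ = 1/(10000·C₀). Then there exists an integer R₀ such that for every integer R ≥ R₀, with M = ⌊C̃ · R^{(1+η)/η} · (log R)^{−1/2}⌋, one has ∑_{L=R}^{M} binom(M, L) · 100·R · 7^L · (C₀ · (log R)^{η/2} · M^{η−1} · R^{−η/2} · L^{−η/2})^L < 2^{−R}. -/

import Mathlib

theorem Nat.choose_le_exp_mul_div_pow (M L : ℕ) (hL : 0 < L) :
    (M.choose L : ℝ) ≤ (Real.exp 1 * (M / L)) ^ L := by
  have hL' : (0 : ℝ) < L := by exact_mod_cast hL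
  have hfac : (0 : ℝ) < L.factorial := by exact_mod_cast L.factorial_pos
  have hexp : (L : ℝ) ^ L / L.factorial ≤ Real.exp 1 ^ L := by
    rw [← Real.exp_nat_mul, mul_one]
    exact Real.pow_div_factorial_le_exp L hL'.le L
  calc (M.choose L : ℝ) ≤ (M : ℝ) ^ L / L.factorial := Nat.choose_le_pow_div L M
    _ = (L : ℝ) ^ L / L.factorial * (M / L) ^ L := by
        rw [div_pow]; field_simp
    _ ≤ Real.exp 1 ^ L * (M / L) ^ L := by gcongr
    _ = (Real.exp 1 * (M / L)) ^ L := (mul_pow _ _ _).symm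

theorem rpow_le_of_le_mul_rpow_div {η c r l m : ℝ} (hη : 1 ≤ η) (hc : 0 < c) (hc1 : c ≤ 1)
    (hr : 0 < r) (hl : 0 < l) (hm : 0 ≤ m)
    (h : m ≤ c * r ^ ((1 + η) / η) * l ^ (-(1 / 2 : ℝ))) :
    m ^ η ≤ c * r ^ (1 + η) * l ^ (-(η / 2)) := by
  have hη0 : 0 < η := by linarith
  calc m ^ η ≤ (c * r ^ ((1 + η) / η) * l ^ (-(1 / 2 : ℝ))) ^ η := by gcongr
    _ = c ^ η * r ^ (1 + η) * l ^ (-(η / 2)) := by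
        rw [Real.mul_rpow (by positivity) (by positivity),
          Real.mul_rpow (by positivity) (by positivity), ← Real.rpow_mul hr.le,
          ← Real.rpow_mul hl.le, div_mul_cancel₀ _ hη0.ne']
        congr 2
        ring
    _ ≤ c * r ^ (1 + η) * l ^ (-(η / 2)) := by
        gcongr
        simpa using Real.rpow_le_rpow_of_exponent_ge hc hc1 hη

theorem div_mul_attachment_bound_le {η C c r l m x : ℝ} (hη : 1 ≤ η) (hC : 0 ≤ C) (hc : 0 < c)
    (hc1 : c ≤ 1) (hr : 0 < r) (hl : 0 < l) (hm : 0 < m) (hrx : r ≤ x)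
    (h : m ≤ c * r ^ ((1 + η) / η) * l ^ (-(1 / 2 : ℝ))) :
    m / x * (C * l ^ (η / 2) * m ^ (η - 1) * r ^ (-(η / 2)) * x ^ (-(η / 2))) ≤ C * c := by
  have hx : 0 < x := hr.trans_le hrx
  have hm_rpow : m * m ^ (η - 1) = m ^ η := by
    rw [Real.rpow_sub_one hm.ne']; field_simp
  have hl_rpow : l ^ (η / 2) * l ^ (-(η / 2)) = 1 := by
    rw [← Real.rpow_add hl]; simp
  have hr_rpow : r ^ (1 + η) * r ^ (-(η / 2)) = r ^ (1 + η / 2) := by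
    rw [← Real.rpow_add hr]; congr 1; ring
  have hx_rpow : x⁻¹ * x ^ (-(η / 2)) = (x ^ (1 + η / 2))⁻¹ := by
    rw [← Real.rpow_neg_one, ← Real.rpow_add hx, ← Real.rpow_neg hx.le]; congr 1; ring
  calc m / x * (C * l ^ (η / 2) * m ^ (η - 1) * r ^ (-(η / 2)) * x ^ (-(η / 2)))
      = C * l ^ (η / 2) * (m * m ^ (η - 1)) * r ^ (-(η / 2)) * (x⁻¹ * x ^ (-(η / 2))) := by
        rw [div_eq_mul_inv]; ring
    _ ≤ C * l ^ (η / 2) * (c * r ^ (1 + η) * l ^ (-(η / 2))) * r ^ (-(η / 2)) *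
          (x⁻¹ * x ^ (-(η / 2))) := by
        rw [hm_rpow]
        gcongr
        exact rpow_le_of_le_mul_rpow_div hη hc hc1 hr hl hm.le h
    _ = C * c * (l ^ (η / 2) * l ^ (-(η / 2))) * (r ^ (1 + η) * r ^ (-(η / 2))) *
          (x⁻¹ * x ^ (-(η / 2))) := by ring
    _ = C * c * (r ^ (1 + η / 2) / x ^ (1 + η / 2)) := by
        rw [hl_rpow, hr_rpow, hx_rpow]; ring
    _ ≤ C * c * 1 := by
        gcongr
        exact div_le_one_of_le₀ (by gcongr) (by positivity)
    _ = C * c := mul_one _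

theorem sum_Icc_mul_eighth_pow_lt {R : ℕ} (hR : 10 ≤ R) (M : ℕ) :
    ∑ L ∈ Finset.Icc R M, 100 * (R : ℝ) * (1 / 8) ^ L < (2 : ℝ) ^ (-(R : ℝ)) := by
  have hgeom : ∑ L ∈ Finset.Icc R M, (1 / 8 : ℝ) ^ L ≤ (1 / 8) ^ R / (1 - 1 / 8) := by
    rw [← Finset.Ico_add_one_right_eq_Icc]
    exact geom_sum_Ico_le_of_lt_one (by norm_num) (by norm_num)
  have hlt : (R : ℝ) < 2 ^ R := by exact_mod_cast R.lt_two_pow_self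
  have hbig : (1024 : ℝ) ≤ 2 ^ R := by
    calc (1024 : ℝ) = 2 ^ 10 := by norm_num
      _ ≤ 2 ^ R := by gcongr; norm_num
  have hpow : (2 : ℝ) ^ (-(R : ℝ)) = (1 / 8) ^ R * (2 ^ R * 2 ^ R) := by
    rw [Real.rpow_neg (by norm_num), Real.rpow_natCast, ← mul_pow, ← mul_pow, ← inv_pow]
    norm_num
  rw [← Finset.mul_sum, hpow]
  calc 100 * (R : ℝ) * ∑ L ∈ Finset.Icc R M, (1 / 8 : ℝ) ^ L
      ≤ 100 * R * ((1 / 8) ^ R / (1 - 1 / 8)) := by gcongr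
    _ = (1 / 8) ^ R * (800 / 7 * R) := by ring
    _ < (1 / 8) ^ R * (2 ^ R * 2 ^ R) := by
        gcongr
        nlinarith


/-- Key quantitative estimate in the proof of Theorem 1.4 (DBM-η on ℤ³, η ≥ 1):
with `C̃ = 1/(10000·C₀)` and `M = ⌊C̃ · R^((1+η)/η) · (log R)^(−1/2)⌋`, for all
large `R` the union-bound sum
`∑_{L=R}^{M} binom(M,L)·100·R·7^L·(C₀·(log R)^(η/2)·M^(η−1)·R^(−η/2)·L^(−η/2))^L`
is less than `2^(−R)`. -/
theorem stmt_9 (η C₀ : ℝ) (hη : 1 ≤ η) (hC₀ : 1 ≤ C₀)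
    (Ct : ℝ) (hCt : Ct = 1 / (10000 * C₀)) :
    ∃ R₀ : ℕ, ∀ R : ℕ, R₀ ≤ R →
      ∀ M : ℕ, M = ⌊Ct * (R : ℝ) ^ ((1 + η) / η) * Real.log R ^ (-(1 / 2 : ℝ))⌋₊ →
        ∑ L ∈ Finset.Icc R M,
            (M.choose L : ℝ) * (100 * R) * 7 ^ L *
              (C₀ * Real.log R ^ (η / 2) * (M : ℝ) ^ (η - 1) * (R : ℝ) ^ (-(η / 2)) *
                (L : ℝ) ^ (-(η / 2))) ^ L <
          (2 : ℝ) ^ (-(R : ℝ)) := by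
  refine ⟨10, fun R hR M hM => ?_⟩
  have hr : (0 : ℝ) < R := by exact_mod_cast (by lia : 0 < R)
  have hl : 0 < Real.log R := Real.log_pos (by exact_mod_cast (by lia : 1 < R))
  have hc : 0 < Ct := by rw [hCt]; positivity
  have hCCt : C₀ * Ct = 1 / 10000 := by rw [hCt]; field_simp
  have hc1 : Ct ≤ 1 := by nlinarith
  have hM_le : (M : ℝ) ≤ Ct * (R : ℝ) ^ ((1 + η) / η) * Real.log R ^ (-(1 / 2 : ℝ)) := by
    rw [hM]
    exact Nat.floor_le (by positivity)
  refine (Finset.sum_le_sum fun L hL => ?_).trans_lt (sum_Icc_mul_eighth_pow_lt hR M)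
  obtain ⟨hRL, hLM⟩ := Finset.mem_Icc.mp hL
  have hbase := div_mul_attachment_bound_le (C := C₀) (x := L) hη (by linarith) hc hc1 hr hl
    (by exact_mod_cast (by lia : 0 < M)) (by exact_mod_cast hRL) hM_le
  set b := C₀ * Real.log R ^ (η / 2) * (M : ℝ) ^ (η - 1) * (R : ℝ) ^ (-(η / 2)) *
    (L : ℝ) ^ (-(η / 2))
  have hb : 0 ≤ b := by positivity
  calc (M.choose L : ℝ) * (100 * R) * 7 ^ L * b ^ L
      ≤ (Real.exp 1 * (M / L)) ^ L * (100 * R) * 7 ^ L * b ^ L := by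
        gcongr
        exact Nat.choose_le_exp_mul_div_pow M L (by lia)
    _ = 100 * R * (7 * Real.exp 1 * (M / L * b)) ^ L := by
        simp only [mul_pow]; ring
    _ ≤ 100 * R * (1 / 8) ^ L := by
        gcongr
        calc 7 * Real.exp 1 * (M / L * b) ≤ 7 * 3 * (1 / 10000) := by
              rw [← hCCt]
              gcongr
              exact Real.exp_one_lt_three.le
          _ ≤ 1 / 8 := by norm_num
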